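/- Let A be an n×n unitary complex matrix and Y an n×n complex matrix satisfying A*Y + Y*A = 0 (i.e., Y is tangent to the unitary group at A). Then A + Y is invertible. -/

import Mathlib

open Matrix

/-- If `A` is unitary and `Y` is tangent to the unitary group at `A`
(`A*Y + Y*A = 0`), then `A + Y` is invertible. -/
theorem tangent_implies_invertible {n : ℕ} (A Y : Matrix (Fin n) (Fin n) ℂ)
    (hA : A * Aᴴ = 1) (hY : Aᴴ * Y + Yᴴ * A = 0) :
    IsUnit (A + Y) := by
  open scoped ComplexOrder in
  have hgram : (A + Y)ᴴ * (A + Y) = 1 + Yᴴ * Y := by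
    calc (A + Y)ᴴ * (A + Y) = Aᴴ * A + (Aᴴ * Y + Yᴴ * A) + Yᴴ * Y := by
          rw [conjTranspose_add]; noncomm_ring
      _ = 1 + Yᴴ * Y := by rw [hY, mul_eq_one_comm.mp hA, add_zero]
  have hunit : IsUnit ((A + Y)ᴴ * (A + Y)) := by
    rw [hgram]
    exact (PosDef.one.add_posSemidef (posSemidef_conjTranspose_mul_self Y)).isUnit
  rw [isUnit_iff_isUnit_det, det_mul] at hunit
  exact (isUnit_iff_isUnit_det _).mpr (isUnit_of_mul_isUnit_right hunit)
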